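/- Suppose the Jacobi parameters satisfy a_n → 1, b_n → 0, and Σ_{n=1}^∞ (|a_{n+1} − a_n| + |b_{n+1} − b_n|) < ∞. Then for every ε ∈ (0, 2) there is uniform clock behavior on [−2+ε, 2−ε]: sup{ | n(E′ − E) − π·√(4 − E²) | : E < E′ successive zeros of p_n with E, E′ ∈ [−2+ε, 2−ε] } → 0 as n → ∞. -/

import Mathlib

open scoped BigOperators

/-- The orthonormal polynomials for Jacobi parameters `a`, `b`:
`orthoP a b n` is `p_{n-1}`, so that `orthoP a b 0 = p₋₁ = 0`, `orthoP a b 1 = p₀ = 1`,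
and `a (n+1) * p (n+1) = (x - b (n+1)) * p n - a n * p (n-1)`. -/
noncomputable def orthoPAux (a b : ℕ → ℝ) : ℕ → ℝ → ℝ
  | 0 => fun _ => 0
  | 1 => fun _ => 1
  | (n+2) => fun x =>
      ((x - b (n+1)) * orthoPAux a b (n+1) x - a n * orthoPAux a b n x) / a (n+1)

/-- The orthonormal polynomial `p n` evaluated at `x`. -/
noncomputable def orthoP (a b : ℕ → ℝ) (n : ℕ) (x : ℝ) : ℝ := orthoPAux a b (n+1) x

noncomputable def ccJ (a b : ℕ → ℝ) (k : ℕ) (x : ℝ) : ℝ := (x - b (k+1)) / (2 * a (k+1))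
noncomputable def ssJ (a b : ℕ → ℝ) (k : ℕ) (x : ℝ) : ℝ := Real.sqrt (1 - ccJ a b k x ^ 2)
noncomputable def thJ (a b : ℕ → ℝ) (k : ℕ) (x : ℝ) : ℝ := Real.arccos (ccJ a b k x)
noncomputable def zJ (a b : ℕ → ℝ) (k : ℕ) (x : ℝ) : ℂ := ⟨ccJ a b k x, ssJ a b k x⟩
noncomputable def phJ (a b : ℕ → ℝ) (k : ℕ) (x : ℝ) : ℂ :=
  ⟨orthoPAux a b (k+1) x - ccJ a b k x * orthoPAux a b k x, ssJ a b k x * orthoPAux a b k x⟩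

theorem orthoPAux_rec (a b : ℕ → ℝ) (ha : ∀ n, 0 < a n) (n : ℕ) (x : ℝ) :
    a (n+1) * orthoPAux a b (n+2) x = (x - b (n+1)) * orthoPAux a b (n+1) x
      - a n * orthoPAux a b n x := by
  rw [orthoPAux]
  have := (ha (n+1)).ne'
  field_simp

theorem orthoPAux_cont (a b : ℕ → ℝ) (n : ℕ) : Continuous (orthoPAux a b n) ∧
    Continuous (orthoPAux a b (n+1)) := by
  induction n with
  | zero => exact ⟨by simp only [orthoPAux]; fun_prop, by simp only [orthoPAux]; fun_prop⟩
  | succ n ih =>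
    refine ⟨ih.2, ?_⟩
    have h1 := ih.1
    have h2 := ih.2
    simp only [orthoPAux]
    fun_prop

theorem orthoPAux_ne (a b : ℕ → ℝ) (ha : ∀ n, 0 < a n) (n : ℕ) (x : ℝ) :
    ¬ (orthoPAux a b n x = 0 ∧ orthoPAux a b (n+1) x = 0) := by
  induction n with
  | zero => simp [orthoPAux]
  | succ n ih =>
    rintro ⟨h1, h2⟩
    apply ih
    refine ⟨?_, h1⟩
    have := orthoPAux_rec a b ha n x
    rw [h2, h1] at this
    have h3 := (ha n).ne'
    have : a n * orthoPAux a b n x = 0 := by linarith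
    simpa [h3] using this

/-- Christoffel-Darboux -/
theorem orthoPAux_CD (a b : ℕ → ℝ) (ha : ∀ n, 0 < a n) (n : ℕ) (x y : ℝ) :
    a n * (orthoPAux a b (n+1) x * orthoPAux a b n y - orthoPAux a b n x * orthoPAux a b (n+1) y)
      = (x - y) * ∑ j ∈ Finset.range (n+1), orthoPAux a b j x * orthoPAux a b j y := by
  induction n with
  | zero => simp [orthoPAux]
  | succ n ih =>
    rw [Finset.sum_range_succ, mul_add, ← ih]
    have h1 := orthoPAux_rec a b ha n x
    have h2 := orthoPAux_rec a b ha n y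
    linear_combination orthoPAux a b (n+1) y * h1 - orthoPAux a b (n+1) x * h2

theorem interlaceJ (a b : ℕ → ℝ) (ha : ∀ n, 0 < a n) (n : ℕ) (E E' : ℝ) (hlt : E < E')
    (h0 : orthoPAux a b (n+1) E = 0) (h0' : orthoPAux a b (n+1) E' = 0)
    (hne : ∀ x ∈ Set.Ioo E E', orthoPAux a b (n+1) x ≠ 0) :
    orthoPAux a b (n+2) E * orthoPAux a b (n+2) E' < 0 := by
  -- near each zero the kernel is positive
  have hpos : ∀ y : ℝ, ∀ᶠ x in nhds y,
      0 < ∑ j ∈ Finset.range (n+2), orthoPAux a b j x * orthoPAux a b j y := by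
    intro y
    have hc : Continuous (fun x => ∑ j ∈ Finset.range (n+2),
        orthoPAux a b j x * orthoPAux a b j y) := by
      refine continuous_finsetSum _ fun j _ => ?_
      exact (orthoPAux_cont a b j).1.mul continuous_const
    refine hc.continuousAt.eventually (lt_mem_nhds ?_)
    refine Finset.sum_pos' (fun j _ => mul_self_nonneg _) ⟨1, by simp, ?_⟩
    simp [orthoPAux]
  have hE : ∀ᶠ x in nhdsWithin E (Set.Ioi E), x ∈ Set.Ioo E E' ∧
      0 < ∑ j ∈ Finset.range (n+2), orthoPAux a b j x * orthoPAux a b j E :=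
    Filter.Eventually.and (Ioo_mem_nhdsGT hlt) (nhdsWithin_le_nhds (hpos E))
  have hE' : ∀ᶠ x in nhdsWithin E' (Set.Iio E'), x ∈ Set.Ioo E E' ∧
      0 < ∑ j ∈ Finset.range (n+2), orthoPAux a b j x * orthoPAux a b j E' :=
    Filter.Eventually.and (Ioo_mem_nhdsLT hlt) (nhdsWithin_le_nhds (hpos E'))
  obtain ⟨x, hx, hxp⟩ := hE.exists
  obtain ⟨y, hy, hyp⟩ := hE'.exists
  have c1 := orthoPAux_CD a b ha (n+1) x E
  have c2 := orthoPAux_CD a b ha (n+1) y E'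
  rw [h0] at c1
  rw [h0'] at c2
  have c1' := mul_pos (sub_pos.2 hx.1) hxp
  have c2' := mul_pos (sub_pos.2 hy.2) hyp
  have d1 : orthoPAux a b (n+1) x * orthoPAux a b (n+2) E < 0 := by
    have : 0 < a (n+1) * -(orthoPAux a b (n+1) x * orthoPAux a b (n+2) E) := by linarith
    have := (mul_pos_iff_of_pos_left (ha (n+1))).1 this
    linarith
  have d2 : 0 < orthoPAux a b (n+1) y * orthoPAux a b (n+2) E' := by
    have : 0 < a (n+1) * (orthoPAux a b (n+1) y * orthoPAux a b (n+2) E') := by linarith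
    exact (mul_pos_iff_of_pos_left (ha (n+1))).1 this
  -- same sign
  have d3 : 0 < orthoPAux a b (n+1) x * orthoPAux a b (n+1) y := by
    by_contra hcon
    push Not at hcon
    have hc := (orthoPAux_cont a b (n+1)).1
    have hz : (0:ℝ) ∈ Set.uIcc (orthoPAux a b (n+1) x) (orthoPAux a b (n+1) y) := by
      rw [Set.mem_uIcc]
      rcases mul_nonpos_iff.1 hcon with h | h
      · right; exact ⟨h.2, h.1⟩
      · left; exact h
    obtain ⟨w, hw, hw0⟩ := intermediate_value_uIcc hc.continuousOn hz
    have hsub : Set.uIcc x y ⊆ Set.Ioo E E' := Set.ordConnected_Ioo.uIcc_subset hx hy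
    exact hne w (hsub hw) hw0
  by_contra hcon
  push Not at hcon
  have e1 := mul_neg_of_neg_of_pos d1 d2
  have e2 := mul_nonneg d3.le hcon
  nlinarith

theorem phJ_norm_facts (a b : ℕ → ℝ) (k : ℕ) (x s0 : ℝ) (hs0 : 0 < s0)
    (hs : s0 ≤ ssJ a b k x) (hc : |ccJ a b k x| ≤ 1) :
    |orthoPAux a b k x| ≤ ‖phJ a b k x‖ / s0 ∧
    |orthoPAux a b (k+1) x| ≤ ‖phJ a b k x‖ * (1 + 1 / s0) := by
  have h1 : |orthoPAux a b k x| ≤ ‖phJ a b k x‖ / s0 := by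
    rw [le_div_iff₀ hs0]
    have := Complex.abs_im_le_norm (phJ a b k x)
    simp only [phJ, abs_mul] at this
    rw [abs_of_nonneg (hs0.le.trans hs)] at this
    have h2 := mul_le_mul_of_nonneg_right hs (abs_nonneg (orthoPAux a b k x))
    simp only [phJ]
    linarith
  refine ⟨h1, ?_⟩
  have h3 := Complex.abs_re_le_norm (phJ a b k x)
  have h4 : |orthoPAux a b (k+1) x| ≤ |(phJ a b k x).re| + |orthoPAux a b k x| := by
    have : orthoPAux a b (k+1) x = (phJ a b k x).re + ccJ a b k x * orthoPAux a b k x := by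
      simp [phJ]
    rw [this]
    refine (abs_add_le _ _).trans ?_
    rw [abs_mul]
    nlinarith [abs_nonneg (orthoPAux a b k x)]
  have : ‖phJ a b k x‖ * (1 + 1 / s0) = ‖phJ a b k x‖ + ‖phJ a b k x‖ / s0 := by ring
  linarith

theorem phJ_ne (a b : ℕ → ℝ) (ha : ∀ n, 0 < a n) (k : ℕ) (x s0 : ℝ) (hs0 : 0 < s0)
    (hs : s0 ≤ ssJ a b k x) (hc : |ccJ a b k x| ≤ 1) : phJ a b k x ≠ 0 := by
  intro h
  obtain ⟨h1, h2⟩ := phJ_norm_facts a b k x s0 hs0 hs hc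
  rw [h] at h1 h2
  simp at h1 h2
  exact orthoPAux_ne a b ha k x ⟨h1, h2⟩

theorem zJ_diff (a b : ℕ → ℝ) (k : ℕ) (x s0 : ℝ) (hs0 : 0 < s0)
    (ha : 1/2 ≤ a (k+2)) (ha1 : 0 < a (k+1))
    (hs : s0 ≤ ssJ a b k x) (hc : |ccJ a b k x| ≤ 1)
    (hs' : s0 ≤ ssJ a b (k+1) x) (hc' : |ccJ a b (k+1) x| ≤ 1) :
    |ccJ a b k x - ccJ a b (k+1) x| ≤ 2 * (|a (k+2) - a (k+1)| + |b (k+2) - b (k+1)|) ∧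
    |ssJ a b k x - ssJ a b (k+1) x| ≤
      2 * (|a (k+2) - a (k+1)| + |b (k+2) - b (k+1)|) / s0 := by
  have hA : |ccJ a b k x - ccJ a b (k+1) x| ≤
      2 * (|a (k+2) - a (k+1)| + |b (k+2) - b (k+1)|) := by
    have ha2 : 0 < a (k+2) := by linarith
    have e : ccJ a b k x - ccJ a b (k+1) x =
        (ccJ a b k x * (a (k+2) - a (k+1)) + (b (k+2) - b (k+1)) / 2) / a (k+2) := by
      simp only [ccJ]
      field_simp
      ring
    rw [e, abs_div, abs_of_pos ha2, div_le_iff₀ ha2]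
    have t1 : |ccJ a b k x * (a (k+2) - a (k+1)) + (b (k+2) - b (k+1)) / 2| ≤
        |a (k+2) - a (k+1)| + |b (k+2) - b (k+1)| := by
      refine (abs_add_le _ _).trans ?_
      rw [abs_mul, abs_div, abs_two]
      nlinarith [abs_nonneg (a (k+2) - a (k+1)), abs_nonneg (b (k+2) - b (k+1))]
    have : 0 ≤ |a (k+2) - a (k+1)| + |b (k+2) - b (k+1)| := by positivity
    nlinarith
  refine ⟨hA, ?_⟩
  rw [le_div_iff₀ hs0]
  refine le_trans ?_ hA
  have q1 : ssJ a b k x ^ 2 = 1 - ccJ a b k x ^ 2 :=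
    Real.sq_sqrt (by nlinarith [abs_le.1 hc])
  have q2 : ssJ a b (k+1) x ^ 2 = 1 - ccJ a b (k+1) x ^ 2 :=
    Real.sq_sqrt (by nlinarith [abs_le.1 hc'])
  have q3 : |ssJ a b k x - ssJ a b (k+1) x| * (ssJ a b k x + ssJ a b (k+1) x) =
      |ccJ a b k x - ccJ a b (k+1) x| * |ccJ a b k x + ccJ a b (k+1) x| := by
    rw [← abs_of_pos (by linarith : 0 < ssJ a b k x + ssJ a b (k+1) x), ← abs_mul, ← abs_mul,
      ← abs_neg]
    congr 1
    linear_combination -q1 + q2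
  have q4 : |ccJ a b k x + ccJ a b (k+1) x| ≤ 2 := (abs_add_le _ _).trans (by linarith)
  have q5 := abs_nonneg (ssJ a b k x - ssJ a b (k+1) x)
  have q6 := abs_nonneg (ccJ a b k x - ccJ a b (k+1) x)
  nlinarith

noncomputable def eeJ (a b : ℕ → ℝ) (k : ℕ) : ℝ :=
  |a (k+1) - a k| + (|a (k+2) - a (k+1)| + |b (k+2) - b (k+1)|)

theorem phJ_step (a b : ℕ → ℝ) (ha : ∀ n, 0 < a n) (k : ℕ) (x s0 : ℝ) (hs0 : 0 < s0)
    (ha1 : 1/2 ≤ a (k+1)) (ha2 : 1/2 ≤ a (k+2))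
    (hs : s0 ≤ ssJ a b k x) (hc : |ccJ a b k x| ≤ 1)
    (hs' : s0 ≤ ssJ a b (k+1) x) (hc' : |ccJ a b (k+1) x| ≤ 1) :
    ‖phJ a b (k+1) x - zJ a b k x * phJ a b k x‖ ≤
      ((2 / s0 + (2 + 2 / s0) * (1 + 1 / s0)) * eeJ a b k) * ‖phJ a b k x‖ := by
  have q1 : ssJ a b k x ^ 2 = 1 - ccJ a b k x ^ 2 :=
    Real.sq_sqrt (by nlinarith [abs_le.1 hc])
  have ha1' := ha (k+1)
  have hr := orthoPAux_rec a b ha k x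
  have hr' : orthoPAux a b (k+2) x = 2 * ccJ a b k x * orthoPAux a b (k+1) x
      - a k / a (k+1) * orthoPAux a b k x := by
    simp only [ccJ]
    field_simp
    linarith
  obtain ⟨n1, n2⟩ := phJ_norm_facts a b k x s0 hs0 hs hc
  obtain ⟨z1, z2⟩ := zJ_diff a b k x s0 hs0 ha2 ha1' hs hc hs' hc'
  have e : phJ a b (k+1) x - zJ a b k x * phJ a b k x =
      (((1 - a k / a (k+1)) * orthoPAux a b k x : ℝ) : ℂ) +
      ((⟨ccJ a b k x - ccJ a b (k+1) x, -(ssJ a b k x - ssJ a b (k+1) x)⟩ : ℂ) *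
        (orthoPAux a b (k+1) x : ℝ)) := by
    apply Complex.ext
    · simp [phJ, zJ, hr']
      linear_combination (orthoPAux a b k x) * q1
    · simp [phJ, zJ]
      ring
  have hE0 : 0 ≤ eeJ a b k := by unfold eeJ; positivity
  have b1 : |1 - a k / a (k+1)| ≤ 2 * eeJ a b k := by
    have : 1 - a k / a (k+1) = (a (k+1) - a k) / a (k+1) := by field_simp
    rw [this, abs_div, abs_of_pos ha1', div_le_iff₀ ha1']
    have : |a (k+1) - a k| ≤ eeJ a b k := by
      unfold eeJ
      have : 0 ≤ |a (k+2) - a (k+1)| + |b (k+2) - b (k+1)| := by positivity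
      linarith
    nlinarith
  have hd : |a (k+2) - a (k+1)| + |b (k+2) - b (k+1)| ≤ eeJ a b k := by
    unfold eeJ
    have := abs_nonneg (a (k+1) - a k)
    linarith
  have b2 : ‖(⟨ccJ a b k x - ccJ a b (k+1) x, -(ssJ a b k x - ssJ a b (k+1) x)⟩ : ℂ)‖ ≤
      (2 + 2 / s0) * eeJ a b k := by
    refine (Complex.norm_le_abs_re_add_abs_im _).trans ?_
    simp only [abs_neg]
    have : 2 * (|a (k+2) - a (k+1)| + |b (k+2) - b (k+1)|) / s0 ≤ 2 * eeJ a b k / s0 := by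
      gcongr
    have e2 : (2 + 2 / s0) * eeJ a b k = 2 * eeJ a b k + 2 * eeJ a b k / s0 := by ring
    linarith
  rw [e]
  refine (norm_add_le _ _).trans ?_
  rw [norm_mul, Complex.norm_real, Complex.norm_real, Real.norm_eq_abs, Real.norm_eq_abs, abs_mul]
  calc _ ≤ (2 * eeJ a b k) * (‖phJ a b k x‖ / s0) +
        ((2 + 2 / s0) * eeJ a b k) * (‖phJ a b k x‖ * (1 + 1 / s0)) := by
        gcongr
    _ = _ := by ring

theorem unifJ (a b : ℕ → ℝ) (ha : ∀ n, 0 < a n)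
    (halim : Filter.Tendsto a Filter.atTop (nhds 1))
    (hblim : Filter.Tendsto b Filter.atTop (nhds 0)) (τ : ℝ) (hτ : 0 < τ) :
    ∃ K : ℕ, ∀ k ≥ K, |a (k+1) - 1| ≤ τ ∧ ∀ x ∈ Set.Icc (-2:ℝ) 2,
      |ccJ a b k x - x / 2| ≤ τ := by
  have hm : 0 < min (τ/4) (1/2) := by positivity
  obtain ⟨K1, hK1⟩ := Metric.tendsto_atTop.1 halim _ hm
  obtain ⟨K2, hK2⟩ := Metric.tendsto_atTop.1 hblim (τ/2) (by positivity)
  refine ⟨max K1 K2, fun k hk => ?_⟩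
  have h1 := hK1 (k+1) (by have := le_max_left K1 K2; omega)
  have h2 := hK2 (k+1) (by have := le_max_right K1 K2; omega)
  rw [Real.dist_eq] at h1 h2
  have h3 := h1.trans_le (min_le_left _ _)
  have h4 := h1.trans_le (min_le_right _ _)
  refine ⟨by linarith, fun x hx => ?_⟩
  have hap := ha (k+1)
  have e : ccJ a b k x - x / 2 = (x * (1 - a (k+1)) - b (k+1)) / (2 * a (k+1)) := by
    simp only [ccJ]
    field_simp
    ring
  rw [sub_zero] at h2
  rw [e, abs_div, abs_of_pos (by positivity : 0 < 2 * a (k+1)), div_le_iff₀ (by positivity)]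
  have t1 : |x * (1 - a (k+1)) - b (k+1)| ≤ 2 * |a (k+1) - 1| + |b (k+1)| := by
    refine (abs_sub _ _).trans ?_
    rw [abs_mul, abs_sub_comm 1]
    have : |x| ≤ 2 := abs_le.2 hx
    gcongr
  have := (abs_lt.1 h4).1
  nlinarith

theorem unif2J (a b : ℕ → ℝ) (ha : ∀ n, 0 < a n)
    (halim : Filter.Tendsto a Filter.atTop (nhds 1))
    (hblim : Filter.Tendsto b Filter.atTop (nhds 0)) (ε : ℝ) (hε : 0 < ε) (hε2 : ε < 2) :
    ∃ K : ℕ, ∀ k ≥ K, 1/2 ≤ a (k+1) ∧ ∀ x ∈ Set.Icc (-2 + ε) (2 - ε),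
      |ccJ a b k x| ≤ 1 - ε/4 ∧ ε/4 ≤ ssJ a b k x := by
  obtain ⟨K, hK⟩ := unifJ a b ha halim hblim (min (ε/4) (1/2)) (by positivity)
  refine ⟨K, fun k hk => ?_⟩
  obtain ⟨h1, h2⟩ := hK k hk
  refine ⟨by have := (abs_le.1 (h1.trans (min_le_right _ _))).1; linarith, fun x hx => ?_⟩
  have h3 := (h2 x ⟨by linarith [hx.1], by linarith [hx.2]⟩).trans (min_le_left _ _)
  rw [abs_le] at h3
  have h4 : |ccJ a b k x| ≤ 1 - ε/4 := by
    rw [abs_le]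
    constructor <;> linarith [hx.1, hx.2]
  refine ⟨h4, ?_⟩
  unfold ssJ
  apply Real.le_sqrt_of_sq_le
  rw [← sq_abs (ccJ a b k x)]
  have := abs_nonneg (ccJ a b k x)
  nlinarith

theorem zJ_exp (a b : ℕ → ℝ) (k : ℕ) (x : ℝ) (hc : |ccJ a b k x| ≤ 1) :
    zJ a b k x = Complex.exp (thJ a b k x * Complex.I) := by
  rw [Complex.exp_mul_I, ← Complex.ofReal_cos, ← Complex.ofReal_sin]
  have := abs_le.1 hc
  simp only [thJ, Real.sin_arccos, Real.cos_arccos this.1 this.2]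
  apply Complex.ext <;> simp [zJ, ssJ]

theorem phJ_cont (a b : ℕ → ℝ) (k : ℕ) : Continuous (phJ a b k) := by
  have h1 := (orthoPAux_cont a b k).1
  have h2 := (orthoPAux_cont a b k).2
  have h3 : Continuous (ccJ a b k) := by unfold ccJ; fun_prop
  have h4 : Continuous (ssJ a b k) := by unfold ssJ; fun_prop
  have : phJ a b k = fun x => (((orthoPAux a b (k+1) x - ccJ a b k x * orthoPAux a b k x : ℝ) : ℂ)
      + ((ssJ a b k x * orthoPAux a b k x : ℝ) : ℂ) * Complex.I) := by
    funext x
    apply Complex.ext <;> simp [phJ]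
  rw [this]
  fun_prop

theorem tailJ (f : ℕ → ℝ) (hf : Summable f) (κ : ℝ) (hκ : 0 < κ) :
    ∃ M : ℕ, ∀ m ≥ M, ∀ n ≥ m, ∑ j ∈ Finset.Ico m n, f j ≤ κ := by
  have h := hf.hasSum.tendsto_sum_nat.cauchySeq
  obtain ⟨M, hM⟩ := Metric.cauchySeq_iff.1 h κ hκ
  refine ⟨M, fun m hm n hn => ?_⟩
  have := hM n (hm.trans hn) m hm
  rw [Real.dist_eq, ← Finset.sum_Ico_eq_sub _ hn] at this
  exact (le_abs_self _).trans this.le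

theorem prodJ (a b : ℕ → ℝ) (ha : ∀ n, 0 < a n)
    (halim : Filter.Tendsto a Filter.atTop (nhds 1))
    (hblim : Filter.Tendsto b Filter.atTop (nhds 0))
    (hbv : Summable (fun n : ℕ => |a (n+2) - a (n+1)| + |b (n+2) - b (n+1)|))
    (ε : ℝ) (hε : 0 < ε) (hε2 : ε < 2) (κ : ℝ) (hκ : 0 < κ) (hκ1 : κ ≤ 1) (K0 : ℕ) :
    ∃ M ≥ K0, ∀ n ≥ M, ∀ x ∈ Set.Icc (-2 + ε) (2 - ε), ∃ h : ℂ, ‖h‖ ≤ κ ∧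
      phJ a b n x = phJ a b M x * (∏ j ∈ Finset.Ico M n, zJ a b j x) * (1 + h) := by
  obtain ⟨K, hK⟩ := unif2J a b ha halim hblim ε hε hε2
  set s0 := ε / 4 with hs0
  have hs0p : 0 < s0 := by positivity
  set C := 2 / s0 + (2 + 2 / s0) * (1 + 1 / s0) with hC
  have hsum : Summable (fun k => C * eeJ a b k) := by
    refine Summable.mul_left _ ?_
    unfold eeJ
    refine Summable.add ?_ hbv
    rw [← summable_nat_add_iff 1]
    refine Summable.of_nonneg_of_le (fun _ => abs_nonneg _) (fun n => ?_) hbv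
    have := abs_nonneg (b (n+2) - b (n+1))
    simp only [add_assoc]
    norm_num
  obtain ⟨M1, hM1⟩ := tailJ _ hsum (κ/2) (by positivity)
  refine ⟨max K0 (max K M1), le_max_left _ _, ?_⟩
  set M := max K0 (max K M1) with hM
  have hMK : K ≤ M := (le_max_left _ _).trans (le_max_right _ _)
  have hMM : M1 ≤ M := (le_max_right _ _).trans (le_max_right _ _)
  intro n hn x hx
  have hc : ∀ j ≥ M, |ccJ a b j x| ≤ 1 := fun j hj => by
    have := ((hK j (hMK.trans hj)).2 x hx).1
    linarith
  have hs : ∀ j ≥ M, s0 ≤ ssJ a b j x := fun j hj => ((hK j (hMK.trans hj)).2 x hx).2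
  have hne : ∀ j ≥ M, phJ a b j x ≠ 0 := fun j hj => phJ_ne a b ha j x s0 hs0p (hs j hj) (hc j hj)
  have hz : ∀ j ≥ M, ‖zJ a b j x‖ = 1 := fun j hj => by
    rw [zJ_exp a b j x (hc j hj), Complex.norm_exp_ofReal_mul_I]
  have hz0 : ∀ j ≥ M, zJ a b j x ≠ 0 := fun j hj h => by
    have := hz j hj
    rw [h] at this
    simp at this
  set δ : ℕ → ℂ := fun j => (phJ a b (j+1) x - zJ a b j x * phJ a b j x) /
    (zJ a b j x * phJ a b j x) with hδ
  have hδb : ∀ j ≥ M, ‖δ j‖ ≤ C * eeJ a b j := fun j hj => by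
    simp only [hδ]
    rw [norm_div, norm_mul, hz j hj, one_mul, div_le_iff₀ (norm_pos_iff.2 (hne j hj))]
    exact phJ_step a b ha j x s0 hs0p (hK j (hMK.trans hj)).1
      (hK (j+1) (by omega)).1 (hs j hj) (hc j hj) (hs (j+1) (by omega)) (hc (j+1) (by omega))
  have hprod : ∀ n ≥ M, phJ a b n x = phJ a b M x * (∏ j ∈ Finset.Ico M n, zJ a b j x) *
      ∏ j ∈ Finset.Ico M n, (1 + δ j) := by
    intro n hn
    induction n, hn using Nat.le_induction with
    | base => simp
    | succ m hm ih =>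
      rw [Finset.prod_Ico_succ_top hm, Finset.prod_Ico_succ_top hm]
      have h1 := hne m hm
      have h2 := hz0 m hm
      have : phJ a b (m+1) x = phJ a b m x * zJ a b m x * (1 + δ m) := by
        simp only [hδ]
        field_simp
        ring
      rw [this]
      nth_rw 1 [ih]
      ring
  refine ⟨∏ j ∈ Finset.Ico M n, (1 + δ j) - 1, ?_, by rw [hprod n hn]; ring⟩
  have h1 := Finset.norm_prod_one_add_sub_one_le (Finset.Ico M n) δ
  have h2 : ∑ j ∈ Finset.Ico M n, ‖δ j‖ ≤ κ / 2 := by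
    refine le_trans (Finset.sum_le_sum fun j hj => ?_) (hM1 M hMM n hn)
    exact hδb j (Finset.mem_Ico.1 hj).1
  have h3 : 0 ≤ ∑ j ∈ Finset.Ico M n, ‖δ j‖ := Finset.sum_nonneg fun _ _ => norm_nonneg _
  have h4 := Real.abs_exp_sub_one_le (x := ∑ j ∈ Finset.Ico M n, ‖δ j‖)
    (by rw [abs_of_nonneg h3]; linarith)
  rw [abs_of_nonneg h3] at h4
  have h5 := le_abs_self (Real.exp (∑ j ∈ Finset.Ico M n, ‖δ j‖) - 1)
  linarith

theorem compJ (a b : ℕ → ℝ) (ha : ∀ n, 0 < a n)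
    (halim : Filter.Tendsto a Filter.atTop (nhds 1))
    (hblim : Filter.Tendsto b Filter.atTop (nhds 0))
    (hbv : Summable (fun n : ℕ => |a (n+2) - a (n+1)| + |b (n+2) - b (n+1)|))
    (ε : ℝ) (hε : 0 < ε) (hε2 : ε < 2) (κ : ℝ) (hκ : 0 < κ) (hκ1 : κ ≤ 1) (K0 : ℕ) :
    ∃ M ≥ K0, ∃ η > (0:ℝ), ∀ n ≥ M, ∀ E ∈ Set.Icc (-2 + ε) (2 - ε),
      ∀ x ∈ Set.Icc (-2 + ε) (2 - ε), |x - E| ≤ η →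
      ‖phJ a b n x - phJ a b n E * Complex.exp
        (((-∑ j ∈ Finset.Ico M n, (thJ a b j E - thJ a b j x) : ℝ) : ℂ) * Complex.I)‖
        ≤ κ * ‖phJ a b n E‖ := by
  obtain ⟨K, hK⟩ := unif2J a b ha halim hblim ε hε hε2
  have hκ8 : 0 < κ / 8 := by positivity
  obtain ⟨M, hMK, hM⟩ := prodJ a b ha halim hblim hbv ε hε hε2 (κ/8) hκ8 (by linarith) (max K0 K)
  have hMK' : K ≤ M := (le_max_right _ _).trans hMK
  refine ⟨M, (le_max_left _ _).trans hMK, ?_⟩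
  have hcpt : IsCompact (Set.Icc (-2 + ε) (2 - ε)) := isCompact_Icc
  obtain ⟨x0, hx0, hmin⟩ := hcpt.exists_isMinOn ⟨0, by constructor <;> linarith⟩
    (phJ_cont a b M).norm.continuousOn
  have hne0 : 0 < ‖phJ a b M x0‖ := by
    obtain ⟨h1, h2⟩ := (hK M hMK').2 x0 hx0
    exact norm_pos_iff.2 (phJ_ne a b ha M x0 (ε/4) (by positivity) h2 (by linarith))
  have huc := hcpt.uniformContinuousOn_of_continuous (phJ_cont a b M).continuousOn
  obtain ⟨η, hη, hη'⟩ := Metric.uniformContinuousOn_iff_le.1 huc (κ/8 * ‖phJ a b M x0‖)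
    (by positivity)
  refine ⟨η, hη, fun n hn E hE x hx hxE => ?_⟩
  obtain ⟨h, hh, hhx⟩ := hM n hn x hx
  obtain ⟨h', hh', hhE⟩ := hM n hn E hE
  have hc : ∀ j ≥ M, ∀ y ∈ Set.Icc (-2 + ε) (2 - ε), |ccJ a b j y| ≤ 1 := fun j hj y hy => by
    have := ((hK j (hMK'.trans hj)).2 y hy).1
    linarith
  have hZ : ∀ y ∈ Set.Icc (-2 + ε) (2 - ε), ∏ j ∈ Finset.Ico M n, zJ a b j y =
      Complex.exp (((∑ j ∈ Finset.Ico M n, thJ a b j y : ℝ) : ℂ) * Complex.I) := by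
    intro y hy
    rw [Complex.ofReal_sum, Finset.sum_mul, Complex.exp_sum]
    refine Finset.prod_congr rfl fun j hj => ?_
    exact zJ_exp a b j y (hc j (Finset.mem_Ico.1 hj).1 y hy)
  have hZE : (∏ j ∈ Finset.Ico M n, zJ a b j E) * Complex.exp
        (((-∑ j ∈ Finset.Ico M n, (thJ a b j E - thJ a b j x) : ℝ) : ℂ) * Complex.I) =
      ∏ j ∈ Finset.Ico M n, zJ a b j x := by
    rw [hZ E hE, hZ x hx, ← Complex.exp_add]
    congr 1
    rw [Finset.sum_sub_distrib]
    push_cast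
    ring
  have hZ1 : ∀ y ∈ Set.Icc (-2 + ε) (2 - ε), ‖∏ j ∈ Finset.Ico M n, zJ a b j y‖ = 1 := by
    intro y hy
    rw [hZ y hy, Complex.norm_exp_ofReal_mul_I]
  have hd : ‖phJ a b M x - phJ a b M E‖ ≤ κ/8 * ‖phJ a b M E‖ := by
    have := hη' x hx E hE (by rwa [Real.dist_eq])
    rw [dist_eq_norm] at this
    refine this.trans ?_
    gcongr
    exact hmin hE
  have e : phJ a b n x - phJ a b n E * Complex.exp
        (((-∑ j ∈ Finset.Ico M n, (thJ a b j E - thJ a b j x) : ℝ) : ℂ) * Complex.I) =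
      (∏ j ∈ Finset.Ico M n, zJ a b j x) *
        ((phJ a b M x - phJ a b M E) * (1 + h) + phJ a b M E * (h - h')) := by
    rw [hhx, hhE]
    linear_combination -(phJ a b M E * (1 + h')) * hZE
  rw [e, norm_mul, hZ1 x hx, one_mul]
  have n1 : ‖1 + h‖ ≤ 2 := (norm_add_le _ _).trans (by rw [norm_one]; linarith)
  have n2 : ‖h - h'‖ ≤ κ/4 := (norm_sub_le _ _).trans (by linarith)
  have n3 : ‖phJ a b M E‖ * (1/2) ≤ ‖phJ a b n E‖ := by
    rw [hhE, norm_mul, norm_mul, hZ1 E hE, mul_one]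
    gcongr
    have := norm_sub_norm_le (1:ℂ) (-h')
    rw [norm_neg, norm_one, sub_neg_eq_add] at this
    linarith
  calc _ ≤ ‖phJ a b M x - phJ a b M E‖ * ‖1 + h‖ + ‖phJ a b M E‖ * ‖h - h'‖ := by
        refine (norm_add_le _ _).trans ?_
        rw [norm_mul, norm_mul]
    _ ≤ (κ/8 * ‖phJ a b M E‖) * 2 + ‖phJ a b M E‖ * (κ/4) := by gcongr
    _ = κ * (‖phJ a b M E‖ * (1/2)) := by ring
    _ ≤ _ := by gcongr

theorem mvtJ (a b : ℕ → ℝ) (ha : ∀ n, 0 < a n)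
    (halim : Filter.Tendsto a Filter.atTop (nhds 1))
    (hblim : Filter.Tendsto b Filter.atTop (nhds 0))
    (ε : ℝ) (hε : 0 < ε) (hε2 : ε < 2) (κ : ℝ) (hκ : 0 < κ) :
    ∃ K : ℕ, ∃ η > (0:ℝ), ∀ j ≥ K, ∀ E ∈ Set.Icc (-2 + ε) (2 - ε),
      ∀ x ∈ Set.Icc (-2 + ε) (2 - ε), E < x → x - E ≤ η →
      ∃ f : ℝ, |f - Real.sqrt (4 - E^2)| ≤ κ ∧ x - E = f * (thJ a b j E - thJ a b j x) := by
  have hcf : Continuous (fun t : ℝ => Real.sqrt (1 - t^2)) := by fun_prop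
  have huc := (isCompact_Icc (a := (-1:ℝ)) (b := 1)).uniformContinuousOn_of_continuous
    hcf.continuousOn
  obtain ⟨δ, hδ, hδ'⟩ := Metric.uniformContinuousOn_iff_le.1 huc (κ/4) (by positivity)
  obtain ⟨K1, hK1⟩ := unif2J a b ha halim hblim ε hε hε2
  obtain ⟨K2, hK2⟩ := unifJ a b ha halim hblim (min (κ/4) (δ/2)) (by positivity)
  refine ⟨max K1 K2, δ, hδ, fun j hj E hE x hx hlt hle => ?_⟩
  obtain ⟨h1, h2⟩ := hK1 j ((le_max_left _ _).trans hj)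
  obtain ⟨h3, h4⟩ := hK2 j ((le_max_right _ _).trans hj)
  have hap := ha (j+1)
  have hcl : ccJ a b j E < ccJ a b j x := by
    unfold ccJ
    gcongr
  have cE := abs_le.1 (h2 E hE).1
  have cx := abs_le.1 (h2 x hx).1
  have dE := abs_le.1 ((h4 E ⟨by linarith [hE.1], by linarith [hE.2]⟩).trans (min_le_right _ _))
  have dx := abs_le.1 ((h4 x ⟨by linarith [hx.1], by linarith [hx.2]⟩).trans (min_le_right _ _))
  obtain ⟨ξ, hξ, hs⟩ := exists_hasDerivAt_eq_slope Real.arccos (fun t => -(1 / Real.sqrt (1 - t^2)))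
    hcl Real.continuous_arccos.continuousOn (fun t ht => Real.hasDerivAt_arccos
      (by linarith [ht.1]) (by linarith [ht.2]))
  have hξ1 : 0 < 1 - ξ^2 := by nlinarith [hξ.1, hξ.2]
  have hsp : 0 < Real.sqrt (1 - ξ^2) := Real.sqrt_pos.2 hξ1
  have hs1 : Real.sqrt (1 - ξ^2) ≤ 1 := by
    exact Real.sqrt_le_iff.2 ⟨by norm_num, by nlinarith [sq_nonneg ξ]⟩
  have hE4 : Real.sqrt (4 - E^2) = 2 * Real.sqrt (1 - (E/2)^2) := by
    rw [show 4 - E^2 = 2^2 * (1 - (E/2)^2) by ring, Real.sqrt_mul (by positivity),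
      Real.sqrt_sq (by norm_num)]
  refine ⟨2 * a (j+1) * Real.sqrt (1 - ξ^2), ?_, ?_⟩
  · have q := hδ' ξ ⟨by linarith [hξ.1], by linarith [hξ.2]⟩ (E/2)
      ⟨by linarith [hE.1], by linarith [hE.2]⟩ (by
        rw [Real.dist_eq, abs_le]; constructor <;> linarith [hξ.1, hξ.2])
    rw [Real.dist_eq] at q
    have h3' := h3.trans (min_le_left _ _)
    rw [hE4, show 2 * a (j+1) * Real.sqrt (1 - ξ^2) - 2 * Real.sqrt (1 - (E/2)^2) =
      2 * ((a (j+1) - 1) * Real.sqrt (1 - ξ^2)) +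
        2 * (Real.sqrt (1 - ξ^2) - Real.sqrt (1 - (E/2)^2)) by ring]
    refine (abs_add_le _ _).trans ?_
    rw [abs_mul, abs_mul, abs_mul, abs_two, abs_of_pos hsp]
    have := mul_le_mul h3' hs1 hsp.le (by positivity)
    linarith
  · have hd : ccJ a b j x - ccJ a b j E = (x - E) / (2 * a (j+1)) := by
      unfold ccJ; ring
    rw [hd] at hs
    have hxE : x - E ≠ 0 := by linarith
    unfold thJ
    field_simp at hs
    linarith

theorem trigJ (D κ : ℝ) (hκ : 0 < κ) (hκ1 : κ ≤ 1/8) (h0 : 0 ≤ D) (h1 : D < 3 * Real.pi / 2)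
    (hs : |Real.sin D| ≤ κ) (hc : Real.cos D < κ) : |D - Real.pi| ≤ 2 * κ := by
  obtain ⟨y, hy⟩ : ∃ y, y = D - Real.pi := ⟨_, rfl⟩
  rw [← hy]
  have hpi := Real.pi_pos
  have hpi4 := Real.pi_le_four
  have hsy : |Real.sin y| ≤ κ := by rw [hy, Real.sin_sub_pi, abs_neg]; exact hs
  have hcy : -κ < Real.cos y := by rw [hy, Real.cos_sub_pi]; linarith
  have hcp : 0 < Real.cos y := by
    by_contra hcon
    push Not at hcon
    have := Real.sin_sq_add_cos_sq y
    rw [← sq_abs (Real.sin y)] at this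
    have := abs_nonneg (Real.sin y)
    nlinarith
  have hy1 : -(Real.pi / 2) < y := by
    by_contra hcon
    push Not at hcon
    have := Real.cos_nonpos_of_pi_div_two_le_of_le (x := -y) (by linarith) (by linarith)
    rw [Real.cos_neg] at this
    linarith
  have hya : |y| ≤ Real.pi / 2 := abs_le.2 ⟨hy1.le, by linarith⟩
  have h2 := Real.mul_le_sin (abs_nonneg y) hya
  have h3 : Real.sin |y| ≤ κ := by
    rcases abs_cases y with ⟨h, _⟩ | ⟨h, _⟩ <;> rw [h]
    · exact (le_abs_self _).trans hsy
    · rw [Real.sin_neg]; exact (neg_le_abs _).trans hsy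
  have h4 : 2 / Real.pi * |y| ≤ κ := h2.trans h3
  rw [div_mul_eq_mul_div, div_le_iff₀ hpi] at h4
  nlinarith

set_option maxHeartbeats 2000000 in
theorem stmt_5 (a b : ℕ → ℝ) (ha : ∀ n, 0 < a n) (ha0 : a 0 = 1)
    (halim : Filter.Tendsto a Filter.atTop (nhds 1))
    (hblim : Filter.Tendsto b Filter.atTop (nhds 0))
    (hbv : Summable (fun n : ℕ => |a (n+2) - a (n+1)| + |b (n+2) - b (n+1)|))
    (ε : ℝ) (hε : 0 < ε) (hε2 : ε < 2) :
    ∀ εp > (0:ℝ), ∃ N : ℕ, ∀ n ≥ N,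
      ∀ E ∈ Set.Icc (-2 + ε) (2 - ε), ∀ E' ∈ Set.Icc (-2 + ε) (2 - ε),
      E < E' → orthoP a b n E = 0 → orthoP a b n E' = 0 →
      (∀ x ∈ Set.Ioo E E', orthoP a b n x ≠ 0) →
      |(n : ℝ) * (E' - E) - Real.pi * Real.sqrt (4 - E ^ 2)| < εp := by
  intro εp hεp
  have hκ : 0 < min (1/8) (εp/20) := by positivity
  obtain ⟨κ, hκe⟩ : ∃ κ, κ = min (1/8) (εp/20) := ⟨_, rfl⟩
  rw [← hκe] at hκ
  have hκ1 : κ ≤ 1/8 := hκe ▸ min_le_left _ _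
  have hκ2 : κ ≤ εp/20 := hκe ▸ min_le_right _ _
  obtain ⟨K1, hK1⟩ := unif2J a b ha halim hblim ε hε hε2
  obtain ⟨K2, η2, hη2, hK2⟩ := mvtJ a b ha halim hblim ε hε hε2 κ hκ
  obtain ⟨M, hMK, η1, hη1, hM⟩ := compJ a b ha halim hblim hbv ε hε hε2 κ hκ (by linarith)
    (max K1 K2)
  have hMK1 : K1 ≤ M := (le_max_left _ _).trans hMK
  have hMK2 : K2 ≤ M := (le_max_right _ _).trans hMK
  obtain ⟨η, hηe⟩ : ∃ η, η = min η1 η2 := ⟨_, rfl⟩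
  have hη : 0 < η := hηe ▸ lt_min hη1 hη2
  have hηl1 : η ≤ η1 := hηe ▸ min_le_left _ _
  have hηl2 : η ≤ η2 := hηe ▸ min_le_right _ _
  obtain ⟨L, hL⟩ := exists_nat_gt (max (15 / η) ((M + 1) * 30 / εp))
  have hL1 := (le_max_left _ _).trans_lt hL
  have hL2 := (le_max_right _ _).trans_lt hL
  rw [div_lt_iff₀ hη] at hL1
  rw [div_lt_iff₀ hεp] at hL2
  refine ⟨M + L, fun n hn E hE E' hE' hlt h0 h0' hne => ?_⟩
  simp only [orthoP] at h0 h0' hne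
  have hpi := Real.pi_gt_three
  have hpi' := Real.pi_lt_d2
  have hinter := interlaceJ a b ha n E E' hlt h0 h0' hne
  have hMn : M ≤ n + 1 := by omega
  obtain ⟨m, hm⟩ : ∃ m : ℝ, m = ((n + 1 - M : ℕ) : ℝ) := ⟨_, rfl⟩
  have hm' : m = (n:ℝ) + 1 - M := by rw [hm, Nat.cast_sub hMn]; push_cast; ring
  have hmL : (L:ℝ) ≤ m := by rw [hm]; exact_mod_cast (by omega : L ≤ n + 1 - M)
  obtain ⟨D, hD⟩ : ∃ D : ℝ → ℝ, D = fun x => ∑ j ∈ Finset.Ico M (n+1),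
    (thJ a b j E - thJ a b j x) := ⟨_, rfl⟩
  have hDc : Continuous D := by
    rw [hD]
    refine continuous_finsetSum _ fun j _ => ?_
    unfold thJ ccJ
    exact continuous_const.sub (Real.continuous_arccos.comp (by fun_prop))
  have hDE : D E = 0 := by rw [hD]; simp
  have hth : ∀ j, ∀ x, E < x → 0 ≤ thJ a b j E - thJ a b j x := by
    intro j x hx
    have : thJ a b j x ≤ thJ a b j E := by
      unfold thJ
      apply Real.arccos_le_arccos
      unfold ccJ
      have := ha (j+1)
      gcongr
    linarith
  have hD0 : ∀ x, E < x → 0 ≤ D x := by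
    intro x hx
    rw [hD]
    exact Finset.sum_nonneg fun j _ => hth j x hx
  have hDest : ∀ x ∈ Set.Icc (-2 + ε) (2 - ε), E < x → x - E ≤ η →
      |m * (x - E) - Real.sqrt (4 - E^2) * D x| ≤ κ * D x := by
    intro x hx hEx hxη
    have e : m * (x - E) - Real.sqrt (4 - E^2) * D x = ∑ j ∈ Finset.Ico M (n+1),
        ((x - E) - Real.sqrt (4 - E^2) * (thJ a b j E - thJ a b j x)) := by
      rw [Finset.sum_sub_distrib, ← Finset.mul_sum, hD, Finset.sum_const, Nat.card_Ico, hm,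
        nsmul_eq_mul]
    rw [e]
    refine (Finset.abs_sum_le_sum_abs _ _).trans ?_
    rw [hD, Finset.mul_sum]
    refine Finset.sum_le_sum fun j hj => ?_
    obtain ⟨f, hf, hfe⟩ := hK2 j (hMK2.trans (Finset.mem_Ico.1 hj).1) E hE x hx hEx
      (hxη.trans hηl2)
    have h1 := hth j x hEx
    rw [hfe, ← sub_mul, abs_mul, abs_of_nonneg h1]
    gcongr
  have hsq2 : Real.sqrt (4 - E^2) ≤ 2 :=
    Real.sqrt_le_iff.2 ⟨by norm_num, by nlinarith [sq_nonneg E]⟩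
  have hsq0 := Real.sqrt_nonneg (4 - E^2)
  have hDlow : ∀ x ∈ Set.Icc (-2 + ε) (2 - ε), E < x → x - E ≤ η → m * (x - E) ≤ 3 * D x := by
    intro x hx hEx hxη
    have h1 := (abs_le.1 (hDest x hx hEx hxη)).2
    have h2 := hD0 x hEx
    nlinarith
  obtain ⟨ρ, hρ⟩ : ∃ ρ, ρ = orthoPAux a b (n+2) E := ⟨_, rfl⟩
  rw [← hρ] at hinter
  have hρ0 : ρ ≠ 0 := by
    intro h
    rw [h, zero_mul] at hinter
    exact lt_irrefl _ hinter
  have hρp : 0 < |ρ| := abs_pos.2 hρ0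
  have hphE : phJ a b (n+1) E = (ρ : ℂ) := by
    apply Complex.ext
    · simp [phJ, h0, hρ]
    · simp [phJ, h0]
  have hkey : ∀ x ∈ Set.Icc (-2 + ε) (2 - ε), E < x → x - E ≤ η →
      |(phJ a b (n+1) x).re - ρ * Real.cos (D x)| ≤ κ * |ρ| ∧
      |ssJ a b (n+1) x * orthoPAux a b (n+1) x + ρ * Real.sin (D x)| ≤ κ * |ρ| := by
    intro x hx hEx hxη
    have h1 := hM (n+1) hMn E hE x hx (by rw [abs_of_pos (by linarith)]; linarith)
    have hDx : ∑ j ∈ Finset.Ico M (n+1), (thJ a b j E - thJ a b j x) = D x := by rw [hD]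
    rw [hDx, hphE, Complex.norm_real, Real.norm_eq_abs, Complex.exp_mul_I, ← Complex.ofReal_cos,
      ← Complex.ofReal_sin, Real.cos_neg, Real.sin_neg] at h1
    constructor
    · refine le_trans (le_of_eq ?_) ((Complex.abs_re_le_norm _).trans h1)
      congr 1
      simp [-Complex.ofReal_cos, -Complex.ofReal_sin]
    · refine le_trans (le_of_eq ?_) ((Complex.abs_im_le_norm _).trans h1)
      congr 1
      simp [phJ, -Complex.ofReal_cos, -Complex.ofReal_sin]
  have hssp : ∀ x ∈ Set.Icc (-2 + ε) (2 - ε), 0 < ssJ a b (n+1) x := fun x hx =>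
    lt_of_lt_of_le (by positivity) ((hK1 (n+1) (by omega)).2 x hx).2
  have hno : ∀ y, E < y → y ≤ E' → y - E ≤ η → D y < 3 * Real.pi / 2 := by
    intro y hEy hyE' hyη
    by_contra hcon
    push Not at hcon
    obtain ⟨x1, hx1, hx1D⟩ := intermediate_value_Icc hEy.le hDc.continuousOn
      (show Real.pi / 2 ∈ Set.Icc (D E) (D y) from ⟨by rw [hDE]; positivity, by linarith⟩)
    have hEx1 : E < x1 := by
      rcases hx1.1.lt_or_eq with h | h
      · exact h
      · rw [← h, hDE] at hx1D; linarith
    obtain ⟨x2, hx2, hx2D⟩ := intermediate_value_Icc hx1.2 hDc.continuousOn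
      (show 3 * Real.pi / 2 ∈ Set.Icc (D x1) (D y) from ⟨by rw [hx1D]; linarith, hcon⟩)
    have hx1I : x1 ∈ Set.Icc (-2 + ε) (2 - ε) :=
      ⟨by linarith [hE.1], by linarith [hE'.2, hx1.2]⟩
    have hx2I : x2 ∈ Set.Icc (-2 + ε) (2 - ε) :=
      ⟨by linarith [hE.1, hx2.1], by linarith [hE'.2, hx2.2]⟩
    have k1 := (hkey x1 hx1I hEx1 (by linarith [hx1.2])).2
    have k2 := (hkey x2 hx2I (by linarith [hx2.1]) (by linarith [hx2.2])).2
    rw [hx1D, Real.sin_pi_div_two, mul_one] at k1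
    have s3 : Real.sin (3 * Real.pi / 2) = -1 := by
      rw [show 3 * Real.pi / 2 = Real.pi / 2 + Real.pi by ring, Real.sin_add_pi,
        Real.sin_pi_div_two]
    rw [hx2D, s3] at k2
    have p1 := hssp x1 hx1I
    have p2 := hssp x2 hx2I
    have hκρ : κ * |ρ| < |ρ| := by nlinarith
    have hz : (0:ℝ) ∈ Set.uIcc (orthoPAux a b (n+1) x1) (orthoPAux a b (n+1) x2) ∧
        orthoPAux a b (n+1) x2 ≠ 0 := by
      rw [Set.mem_uIcc]
      rw [abs_le] at k1 k2
      rcases lt_or_gt_of_ne hρ0 with h | h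
      · rw [abs_of_neg h] at k1 k2 hκρ
        have g1 : 0 < orthoPAux a b (n+1) x1 := by
          refine (mul_pos_iff_of_pos_left p1).1 (by linarith)
        have g2 : orthoPAux a b (n+1) x2 < 0 := by
          have : 0 < ssJ a b (n+1) x2 * -orthoPAux a b (n+1) x2 := by linarith
          have := (mul_pos_iff_of_pos_left p2).1 this
          linarith
        exact ⟨Or.inr ⟨g2.le, g1.le⟩, g2.ne⟩
      · rw [abs_of_pos h] at k1 k2 hκρ
        have g2 : 0 < orthoPAux a b (n+1) x2 := by
          refine (mul_pos_iff_of_pos_left p2).1 (by linarith)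
        have g1 : orthoPAux a b (n+1) x1 < 0 := by
          have : 0 < ssJ a b (n+1) x1 * -orthoPAux a b (n+1) x1 := by linarith
          have := (mul_pos_iff_of_pos_left p1).1 this
          linarith
        exact ⟨Or.inl ⟨g1.le, g2.le⟩, g2.ne'⟩
    obtain ⟨w, hw, hw0⟩ := intermediate_value_uIcc
      (orthoPAux_cont a b (n+1)).1.continuousOn hz.1
    rw [Set.uIcc_of_le hx2.1] at hw
    have hw2 : w < x2 := by
      rcases hw.2.lt_or_eq with h | h
      · exact h
      · rw [h] at hw0; exact absurd hw0 hz.2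
    exact hne w ⟨by linarith [hw.1], by linarith [hx2.2]⟩ hw0
  have hEE : E' - E ≤ η := by
    by_contra hcon
    push Not at hcon
    have h1 := hno (E + η) (by linarith) (by linarith) (by linarith)
    have h2 := hDlow (E + η) ⟨by linarith [hE.1], by linarith [hE'.2]⟩ (by linarith) (by linarith)
    rw [add_sub_cancel_left] at h2
    have : (L:ℝ) * η ≤ m * η := by gcongr
    linarith
  have hD32 := hno E' hlt le_rfl hEE
  obtain ⟨r1, r2⟩ := hkey E' hE' hlt hEE
  have hDp := hD0 E' hlt
  have hsin : |Real.sin (D E')| ≤ κ := by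
    rw [h0', mul_zero, zero_add, abs_mul, mul_comm] at r2
    exact le_of_mul_le_mul_right r2 hρp
  have hcos : Real.cos (D E') < κ := by
    have e : (phJ a b (n+1) E').re = orthoPAux a b (n+2) E' := by simp [phJ, h0']
    rw [e] at r1
    have h1 : |(orthoPAux a b (n+2) E' - ρ * Real.cos (D E')) * ρ| ≤ κ * |ρ| * |ρ| := by
      rw [abs_mul]; gcongr
    have h2 := (abs_le.1 h1).1
    rw [mul_assoc, abs_mul_abs_self] at h2
    have h3 : 0 < ρ * ρ := mul_self_pos.2 hρ0
    by_contra hcon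
    push Not at hcon
    nlinarith
  have hDpi := trigJ (D E') κ hκ hκ1 hDp hD32 hsin hcos
  have f1 := hDest E' hE' hlt hEE
  have f2 := hDlow E' hE' hlt hEE
  have g1 : κ * D E' ≤ κ * 5 := by gcongr; linarith
  have g2 : Real.sqrt (4 - E^2) * |D E' - Real.pi| ≤ 2 * (2 * κ) := by gcongr
  have g3 : ((M:ℝ) + 1) * (E' - E) < εp / 2 := by
    have hlt' : 0 < E' - E := by linarith
    have hL0 : (0:ℝ) < L := by
      have : (0:ℝ) < (M + 1) * 30 := by positivity
      by_contra hcon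
      push Not at hcon
      nlinarith
    have t1 : L * (E' - E) ≤ 15 := by
      have : L * (E' - E) ≤ m * (E' - E) := by gcongr
      linarith
    have t2 : (((M:ℝ) + 1) * 30) * (E' - E) < (L * εp) * (E' - E) := by gcongr
    have t3 : εp * (L * (E' - E)) ≤ εp * 15 := by gcongr
    nlinarith
  have g4 : |((M:ℝ) - 1) * (E' - E)| ≤ ((M:ℝ) + 1) * (E' - E) := by
    rw [abs_mul, abs_of_pos (by linarith : 0 < E' - E)]
    have : |(M:ℝ) - 1| ≤ M + 1 := by
      rw [abs_le]; constructor <;> linarith [(Nat.cast_nonneg M : (0:ℝ) ≤ M)]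
    have : 0 < E' - E := by linarith
    gcongr
  have e : (n:ℝ) * (E' - E) - Real.pi * Real.sqrt (4 - E^2) =
      ((M:ℝ) - 1) * (E' - E) + (m * (E' - E) - Real.sqrt (4 - E^2) * D E') +
        Real.sqrt (4 - E^2) * (D E' - Real.pi) := by
    rw [hm']; ring
  rw [e]
  have a1 := abs_add_three (((M:ℝ) - 1) * (E' - E))
    (m * (E' - E) - Real.sqrt (4 - E^2) * D E') (Real.sqrt (4 - E^2) * (D E' - Real.pi))
  rw [abs_mul (Real.sqrt (4 - E^2)), abs_of_nonneg hsq0] at a1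
  linarith
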